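/- arXiv:2110.11928 — 2 statements merged into one kernel-verified Lean document; each statement's English description precedes it below -/
import Mathlib

section
/- If an inverse sequence of groups (H_n, f_n) has the Mittag-Leffler property, then for every n ∈ ℕ the image of the inverse limit under the projection equals the intersection of the images of the bonding maps: π_n(L) = ⋂_{m>n} H_{n,m}. Moreover, if m ≥ n is a Mittag-Leffler index for n, then π_n(L) = H_{n,m}. -/
/-- The composite bonding homomorphism `q_{n,n+k} = f_n ∘ ⋯ ∘ f_{n+k-1} : H_{n+k} → H_n`
of an inverse sequence of groups `(H_n, f_n)`. -/
def bondingMap {H : ℕ → Type*} [∀ i, Group (H i)] (f : ∀ i, H (i + 1) →* H i)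
    (n : ℕ) : ∀ k : ℕ, H (n + k) →* H n
  | 0 => MonoidHom.id (H n)
  | (k + 1) => (bondingMap f n k).comp (f (n + k))

/-- The inverse limit of the inverse sequence `(H_n, f_n)`: the subgroup of `∏ n, H n`
consisting of the threads `s` with `f n (s (n+1)) = s n` for all `n`. -/
def inverseLimit {H : ℕ → Type*} [∀ i, Group (H i)] (f : ∀ i, H (i + 1) →* H i) :
    Subgroup (∀ i, H i) where
  carrier := {s | ∀ i, f i (s (i + 1)) = s i}
  one_mem' := fun i => by simp
  mul_mem' := fun {a b} ha hb i => by simp [ha i, hb i]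
  inv_mem' := fun {a} ha i => by simp [ha i]

/-- Every element `x : H N` extends to a family of elements compatible with the bonding maps
in all degrees up to `N`. -/
theorem exists_thread_le {H : ℕ → Type*} [∀ i, Group (H i)] (f : ∀ i, H (i + 1) →* H i) :
    ∀ (N : ℕ) (x : H N), ∃ s : ∀ i, H i, (∀ i < N, f i (s (i + 1)) = s i) ∧ s N = x
  | 0, x => ⟨Function.update 1 0 x, fun i hi => absurd hi (Nat.not_lt_zero i), by simp⟩
  | N + 1, x => by
    obtain ⟨s, hs, hsN⟩ := exists_thread_le f N (f N x)
    refine ⟨Function.update s (N + 1) x, fun i hi => ?_, by simp⟩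
    rw [Function.update_of_ne hi.ne]
    rcases Nat.lt_succ_iff_lt_or_eq.mp hi with h | rfl
    · rw [Function.update_of_ne (by omega), hs i h]
    · rw [Function.update_self, hsN]

theorem bondingMap_apply_of_thread {H : ℕ → Type*} [∀ i, Group (H i)]
    (f : ∀ i, H (i + 1) →* H i) (n k : ℕ) (s : ∀ i, H i)
    (hs : ∀ i < n + k, f i (s (i + 1)) = s i) : bondingMap f n k (s (n + k)) = s n := by
  induction k with
  | zero => rfl
  | succ k ih =>
    have h : bondingMap f n (k + 1) (s (n + (k + 1))) =
        bondingMap f n k (f (n + k) (s (n + k + 1))) := rfl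
    rw [h, hs (n + k) (by omega)]
    exact ih fun i hi => hs i (by omega)

theorem mem_range_bondingMap_iff {H : ℕ → Type*} [∀ i, Group (H i)]
    (f : ∀ i, H (i + 1) →* H i) (n k : ℕ) (y : H n) :
    y ∈ (bondingMap f n k).range ↔
      ∃ s : ∀ i, H i, (∀ i < n + k, f i (s (i + 1)) = s i) ∧ s n = y := by
  constructor
  · rintro ⟨x, rfl⟩
    obtain ⟨s, hs, rfl⟩ := exists_thread_le f (n + k) x
    exact ⟨s, hs, (bondingMap_apply_of_thread f n k s hs).symm⟩
  · rintro ⟨s, hs, rfl⟩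
    exact ⟨s (n + k), bondingMap_apply_of_thread f n k s hs⟩

theorem range_bondingMap_antitone {H : ℕ → Type*} [∀ i, Group (H i)]
    (f : ∀ i, H (i + 1) →* H i) (n : ℕ) : Antitone fun k => (bondingMap f n k).range := by
  intro k l hkl y hy
  obtain ⟨s, hs, hy⟩ := (mem_range_bondingMap_iff f n l y).mp hy
  exact (mem_range_bondingMap_iff f n k y).mpr ⟨s, fun i hi => hs i (by omega), hy⟩

/-- At a Mittag-Leffler index the image of the bonding map is the stable image. -/
theorem range_bondingMap_eq_iInf {H : ℕ → Type*} [∀ i, Group (H i)]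
    (f : ∀ i, H (i + 1) →* H i) {n k : ℕ}
    (hk : ∀ j : ℕ, (bondingMap f n (k + j)).range = (bondingMap f n k).range) :
    (bondingMap f n k).range = ⨅ j : ℕ, (bondingMap f n j).range :=
  le_antisymm
    (le_iInf fun j => (hk j).ge.trans (range_bondingMap_antitone f n (Nat.le_add_left j k)))
    (iInf_le _ k)

/-- For a Mittag-Leffler sequence the bonding maps are surjective on stable images. -/
theorem exists_mem_iInf_range_bondingMap {H : ℕ → Type*} [∀ i, Group (H i)]
    (f : ∀ i, H (i + 1) →* H i) {n k : ℕ}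
    (hk : ∀ j : ℕ, (bondingMap f (n + 1) (k + j)).range = (bondingMap f (n + 1) k).range)
    {y : H n} (hy : y ∈ ⨅ j : ℕ, (bondingMap f n j).range) :
    ∃ x ∈ ⨅ j : ℕ, (bondingMap f (n + 1) j).range, f n x = y := by
  obtain ⟨s, hs, rfl⟩ :=
    (mem_range_bondingMap_iff f n (k + 1) y).mp (Subgroup.mem_iInf.mp hy (k + 1))
  refine ⟨s (n + 1), ?_, hs n (by omega)⟩
  rw [← range_bondingMap_eq_iInf f hk]
  exact (mem_range_bondingMap_iff f (n + 1) k _).mpr ⟨s, fun i hi => hs i (by omega), rfl⟩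

theorem map_eval_inverseLimit_le {H : ℕ → Type*} [∀ i, Group (H i)]
    (f : ∀ i, H (i + 1) →* H i) (n : ℕ) :
    Subgroup.map (Pi.evalMonoidHom H n) (inverseLimit f) ≤
      ⨅ j : ℕ, (bondingMap f n j).range := by
  rintro _ ⟨s, hs, rfl⟩
  exact Subgroup.mem_iInf.mpr fun j =>
    (mem_range_bondingMap_iff f n j _).mpr ⟨s, fun i _ => hs i, rfl⟩

theorem map_eval_inverseLimit_eq_iInf {H : ℕ → Type*} [∀ i, Group (H i)]
    (f : ∀ i, H (i + 1) →* H i)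
    (hML : ∀ n : ℕ, ∃ k : ℕ, ∀ j : ℕ,
      (bondingMap f n (k + j)).range = (bondingMap f n k).range) (n : ℕ) :
    Subgroup.map (Pi.evalMonoidHom H n) (inverseLimit f) =
      ⨅ j : ℕ, (bondingMap f n j).range := by
  refine le_antisymm (map_eval_inverseLimit_le f n) fun y hy => ?_
  have hlift : ∀ i (z : H i), ∃ x : H (i + 1), z ∈ ⨅ j : ℕ, (bondingMap f i j).range →
      x ∈ ⨅ j : ℕ, (bondingMap f (i + 1) j).range ∧ f i x = z := by
    intro i z
    by_cases hz : z ∈ ⨅ j : ℕ, (bondingMap f i j).range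
    · obtain ⟨k, hk⟩ := hML (i + 1)
      obtain ⟨x, hx, hxz⟩ := exists_mem_iInf_range_bondingMap f hk hz
      exact ⟨x, fun _ => ⟨hx, hxz⟩⟩
    · exact ⟨1, fun h => absurd h hz⟩
  choose g hg using hlift
  obtain ⟨t, ht, rfl⟩ := exists_thread_le f n y
  let s : ∀ i, H i := fun i =>
    Nat.rec (motive := H) (t 0) (fun i x => if i < n then t (i + 1) else g i x) i
  have hs_succ : ∀ i, s (i + 1) = if i < n then t (i + 1) else g i (s i) := fun _ => rfl
  have hs_le : ∀ i ≤ n, s i = t i := by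
    rintro (_ | i) hi
    · rfl
    · rw [hs_succ, if_pos (Nat.lt_of_succ_le hi)]
  have hs_mem : ∀ i, n ≤ i → s i ∈ ⨅ j : ℕ, (bondingMap f i j).range := by
    intro i hi
    induction i, hi using Nat.le_induction with
    | base => rwa [hs_le n le_rfl]
    | succ i hi ih =>
      rw [hs_succ, if_neg hi.not_gt]
      exact (hg i (s i) ih).1
  refine ⟨s, fun i => ?_, hs_le n le_rfl⟩
  by_cases hi : i < n
  · rw [hs_le (i + 1) hi, hs_le i hi.le, ht i hi]
  · rw [hs_succ, if_neg hi]
    exact (hg i (s i) (hs_mem i (not_lt.mp hi))).2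

/-- For a Mittag-Leffler inverse sequence of groups, the image of the inverse limit under the
projection `π_n` equals the intersection `⋂_{m>n} H_{n,m}` of the images of the bonding maps;
moreover, if `m = n + k` is a Mittag-Leffler index for `n`, then `π_n(L) = H_{n,m}`. -/
theorem proj_inverseLimit_eq_iInf_range {H : ℕ → Type*} [∀ i, Group (H i)]
    (f : ∀ i, H (i + 1) →* H i)
    (hML : ∀ n : ℕ, ∃ k : ℕ, ∀ j : ℕ,
      (bondingMap f n (k + j)).range = (bondingMap f n k).range) :
    ∀ n : ℕ,
      (Subgroup.map (Pi.evalMonoidHom H n) (inverseLimit f) =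
        ⨅ k : ℕ, (bondingMap f n (k + 1)).range) ∧
      (∀ k : ℕ, (∀ j : ℕ, (bondingMap f n (k + j)).range = (bondingMap f n k).range) →
        Subgroup.map (Pi.evalMonoidHom H n) (inverseLimit f) =
          (bondingMap f n k).range) := by
  intro n
  have h := map_eval_inverseLimit_eq_iInf f hML n
  refine ⟨h.trans (le_antisymm (le_iInf fun k => iInf_le _ (k + 1)) ?_),
    fun k hk => h.trans (range_bondingMap_eq_iInf f hk).symm⟩
  exact le_iInf fun k =>
    (iInf_le _ k).trans (range_bondingMap_antitone f n (Nat.le_succ k))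
end

section
/- In the Hawaiian homology sequence (G_k, f_k): for every k ∈ ℕ and every m ≥ 1, the image of the composite bonding homomorphism G_{k+m} → G_k equals the subgroup W_k := {h ∈ G_k : h(3k+1) = h(3k+2) = h(3k+3)}; W_k is free abelian of rank 3k+2, and the quotient G_k / W_k is isomorphic to ℤ². Hence all the inverse persistent homology groups H_{n,m} (m > n) of the computational Hawaiian earring are free abelian of rank 3n−4 and all the inverse persistent errors E_{n,m} are isomorphic to ℤ². -/
/-- The bonding homomorphism `f_k : G_{k+1} → G_k` of the Hawaiian homology sequence,
where `G_k = (Fin (3k+4) → ℤ)`: `(f_k h)(i) = h(i)` for `i ≤ 3k` and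
`(f_k h)(3k+1) = (f_k h)(3k+2) = (f_k h)(3k+3) = h(3k+1)`. -/
def hawF (k : ℕ) : (Fin (3 * (k + 1) + 4) → ℤ) →+ (Fin (3 * k + 4) → ℤ) where
  toFun h := fun i =>
    if (i : ℕ) ≤ 3 * k then h ⟨(i : ℕ), by omega⟩ else h ⟨3 * k + 1, by omega⟩
  map_zero' := by
    funext i
    by_cases hi : (i : ℕ) ≤ 3 * k <;> simp [hi]
  map_add' a b := by
    funext i
    by_cases hi : (i : ℕ) ≤ 3 * k <;> simp [hi]

/-- The composite bonding homomorphism `G_{k+m} → G_k` of the Hawaiian homology sequence. -/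
def hawBond (k : ℕ) : ∀ m : ℕ, (Fin (3 * (k + m) + 4) → ℤ) →+ (Fin (3 * k + 4) → ℤ)
  | 0 => AddMonoidHom.id _
  | (m + 1) => (hawBond k m).comp (hawF (k + m))

/-- The subgroup `W_k = {h ∈ G_k : h(3k+1) = h(3k+2) = h(3k+3)}`. -/
def hawW (k : ℕ) : AddSubgroup (Fin (3 * k + 4) → ℤ) where
  carrier := {h | h ⟨3 * k + 1, by omega⟩ = h ⟨3 * k + 2, by omega⟩ ∧
    h ⟨3 * k + 2, by omega⟩ = h ⟨3 * k + 3, by omega⟩}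
  zero_mem' := ⟨rfl, rfl⟩
  add_mem' := fun {a b} ha hb =>
    ⟨by simp only [Pi.add_apply, ha.1, hb.1], by simp only [Pi.add_apply, ha.2, hb.2]⟩
  neg_mem' := fun {a} ha =>
    ⟨by simp only [Pi.neg_apply, ha.1], by simp only [Pi.neg_apply, ha.2]⟩

theorem hawF_apply (k : ℕ) (h : Fin (3 * (k + 1) + 4) → ℤ) (i : Fin (3 * k + 4)) :
    hawF k h i =
      if (i : ℕ) ≤ 3 * k then h ⟨(i : ℕ), by omega⟩ else h ⟨3 * k + 1, by omega⟩ :=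
  rfl

theorem mem_hawW {k : ℕ} {h : Fin (3 * k + 4) → ℤ} :
    h ∈ hawW k ↔ h ⟨3 * k + 1, by omega⟩ = h ⟨3 * k + 2, by omega⟩ ∧
      h ⟨3 * k + 2, by omega⟩ = h ⟨3 * k + 3, by omega⟩ :=
  Iff.rfl

theorem mem_hawW_iff_forall {k : ℕ} {h : Fin (3 * k + 4) → ℤ} :
    h ∈ hawW k ↔ ∀ i : Fin (3 * k + 4), 3 * k < (i : ℕ) → h i = h ⟨3 * k + 1, by omega⟩ := by
  rw [mem_hawW]
  constructor
  · rintro ⟨h₁₂, h₂₃⟩ ⟨i, hi⟩ hki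
    obtain rfl | rfl | rfl : i = 3 * k + 1 ∨ i = 3 * k + 2 ∨ i = 3 * k + 3 := by
      dsimp only at hki
      omega
    · rfl
    · exact h₁₂.symm
    · exact (h₁₂.trans h₂₃).symm
  · intro hh
    have h₂ := hh ⟨3 * k + 2, by omega⟩ (by dsimp only; omega)
    have h₃ := hh ⟨3 * k + 3, by omega⟩ (by dsimp only; omega)
    exact ⟨h₂.symm, h₂.trans h₃.symm⟩

/-- All nontrivial composite bonding maps are given by the same formula as `hawF`. -/
theorem hawBond_succ_apply (k m : ℕ) (h : Fin (3 * (k + (m + 1)) + 4) → ℤ)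
    (i : Fin (3 * k + 4)) :
    hawBond k (m + 1) h i =
      if (i : ℕ) ≤ 3 * k then h ⟨(i : ℕ), by omega⟩ else h ⟨3 * k + 1, by omega⟩ := by
  induction m with
  | zero => rfl
  | succ m ih =>
    change hawBond k (m + 1) (hawF (k + (m + 1)) h) i = _
    rw [ih]
    split_ifs with hi
    · rw [hawF_apply, if_pos (by dsimp only; omega)]
    · rw [hawF_apply, if_pos (by dsimp only; omega)]

theorem hawBond_succ_range (k m : ℕ) : (hawBond k (m + 1)).range = hawW k := by
  ext g
  rw [AddMonoidHom.mem_range]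
  constructor
  · rintro ⟨h, rfl⟩
    rw [mem_hawW_iff_forall]
    intro i hi
    rw [hawBond_succ_apply, hawBond_succ_apply, if_neg (by omega),
      if_neg (by dsimp only; omega)]
  · intro hg
    refine ⟨fun j => if hj : (j : ℕ) < 3 * k + 4 then g ⟨j, hj⟩ else 0, ?_⟩
    funext i
    rw [hawBond_succ_apply]
    by_cases hi : (i : ℕ) ≤ 3 * k
    · rw [if_pos hi, dif_pos i.isLt]
    · rw [if_neg hi, dif_pos (by dsimp only; omega)]
      exact (mem_hawW_iff_forall.mp hg i (by omega)).symm

/-- An element of `hawW k` is freely determined by its first `3 * k + 2` coordinates. -/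
def hawWEquiv (k : ℕ) : hawW k ≃+ (Fin (3 * k + 2) → ℤ) where
  toFun h := fun i => h.1 ⟨i, by omega⟩
  invFun g := ⟨fun i => g ⟨min i (3 * k + 1), by omega⟩, by
    rw [mem_hawW_iff_forall]
    intro i hi
    congr 2
    dsimp only
    omega⟩
  left_inv := by
    rintro ⟨h, hh⟩
    ext i
    dsimp only
    by_cases hi : 3 * k < (i : ℕ)
    · rw [mem_hawW_iff_forall.mp hh i hi]
      congr 2
      omega
    · congr 2
      omega
  right_inv g := by
    funext i
    dsimp only
    congr 2
    omega
  map_add' _ _ := rfl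

/-- The consecutive differences of the last three coordinates. -/
def hawDiff (k : ℕ) : (Fin (3 * k + 4) → ℤ) →+ ℤ × ℤ where
  toFun h := (h ⟨3 * k + 1, by omega⟩ - h ⟨3 * k + 2, by omega⟩,
    h ⟨3 * k + 2, by omega⟩ - h ⟨3 * k + 3, by omega⟩)
  map_zero' := by simp
  map_add' a b := by
    ext <;> simp only [Pi.add_apply, Prod.mk_add_mk] <;> ring

theorem hawDiff_ker (k : ℕ) : (hawDiff k).ker = hawW k := by
  ext h
  rw [AddMonoidHom.mem_ker, mem_hawW]
  simp [hawDiff, sub_eq_zero]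

theorem hawDiff_surjective (k : ℕ) : Function.Surjective (hawDiff k) := by
  rintro ⟨a, b⟩
  refine ⟨fun i => if (i : ℕ) = 3 * k + 1 then a else if (i : ℕ) = 3 * k + 3 then -b else 0, ?_⟩
  simp [hawDiff]

/-- In the Hawaiian homology sequence: for every `k` and every `m ≥ 1`, the image of the
composite bonding map `G_{k+m} → G_k` equals `W_k`; `W_k` is free abelian of rank `3k+2`;
and `G_k / W_k ≅ ℤ²`.  (Reindexed by `n = k + 2`: all inverse persistent homology groups
`H_{n,m}`, `m > n`, are free abelian of rank `3n−4` and all inverse persistent errors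
`E_{n,m}` are isomorphic to `ℤ²`.) -/
theorem hawBond_range_eq_hawW :
    ∀ k : ℕ,
      (∀ m : ℕ, 1 ≤ m → (hawBond k m).range = hawW k) ∧
      Nonempty (hawW k ≃+ (Fin (3 * k + 2) → ℤ)) ∧
      Nonempty (((Fin (3 * k + 4) → ℤ) ⧸ hawW k) ≃+ ℤ × ℤ) := by
  intro k
  refine ⟨fun m hm => ?_, ⟨hawWEquiv k⟩, ⟨?_⟩⟩
  · obtain ⟨m, rfl⟩ := Nat.exists_eq_add_of_le' hm
    exact hawBond_succ_range k m
  · rw [← hawDiff_ker]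
    exact QuotientAddGroup.quotientKerEquivOfSurjective (hawDiff k) (hawDiff_surjective k)
end
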